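/- arXiv:1901.08683 — 10 statements merged into one kernel-verified Lean document; each statement's English description precedes it below -/
import Mathlib

section
/- Let A and B be sets, let M ⊆ A → A and M' ⊆ B → B be transformation monoids, and suppose M has a dense subset G consisting of invertible elements of M. Then every continuous monoid homomorphism ξ: M → M' is uniformly continuous (with respect to the uniformities of pointwise convergence). -/
open Set Function

universe u

/-- The uniformity of pointwise convergence on `I → X` arising from the
discrete uniformity on `X`. -/
noncomputable def funUnif (I X : Type*) : UniformSpace (I → X) :=
  @Pi.uniformSpace I (fun _ => X) (fun _ => ⊥)

/-- The topology of pointwise convergence on `I → X` (over discrete `X`). -/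
noncomputable def funTop (I X : Type*) : TopologicalSpace (I → X) :=
  (funUnif I X).toTopologicalSpace

/-- Topological closure w.r.t. the topology of pointwise convergence. -/
def fClosure {I X : Type*} (S : Set (I → X)) : Set (I → X) :=
  @closure _ (funTop I X) S

/-- Closedness w.r.t. the topology of pointwise convergence. -/
def fIsClosed {I X : Type*} (S : Set (I → X)) : Prop :=
  @IsClosed _ (funTop I X) S

/-- Continuity on a set of functions w.r.t. pointwise convergence topologies. -/
def fContinuousOn {I X J Y : Type*} (ξ : (I → X) → (J → Y)) (S : Set (I → X)) : Prop :=
  @ContinuousOn _ _ (funTop I X) (funTop J Y) ξ S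

/-- Uniform continuity on a set of functions w.r.t. pointwise uniformities. -/
def fUniformContinuousOn {I X J Y : Type*} (ξ : (I → X) → (J → Y)) (S : Set (I → X)) : Prop :=
  @UniformContinuousOn _ _ (funUnif I X) (funUnif J Y) ξ S

/-- A transformation monoid on `A`: a set of self-maps containing the identity
and closed under composition. -/
def IsTransMonoid {A : Type*} (M : Set (A → A)) : Prop :=
  id ∈ M ∧ ∀ f ∈ M, ∀ g ∈ M, f ∘ g ∈ M

/-- The set of invertible elements of a transformation monoid `M`. -/
def invertibles {A : Type*} (M : Set (A → A)) : Set (A → A) :=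
  {g | g ∈ M ∧ ∃ f ∈ M, f ∘ g = id ∧ g ∘ f = id}

/-- A monoid homomorphism from `M` to `M'`, given as a (total) map on functions. -/
def MonHomOn {A B : Type*} (M : Set (A → A)) (M' : Set (B → B))
    (ξ : (A → A) → (B → B)) : Prop :=
  Set.MapsTo ξ M M' ∧ ξ id = id ∧ ∀ f ∈ M, ∀ g ∈ M, ξ (f ∘ g) = ξ f ∘ ξ g

/-- A monoid isomorphism between `M` and `M'`, given by a pair of mutually
inverse monoid homomorphisms. -/
def MonIsoOn {A B : Type*} (M : Set (A → A)) (M' : Set (B → B))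
    (ξ : (A → A) → (B → B)) (ξ' : (B → B) → (A → A)) : Prop :=
  MonHomOn M M' ξ ∧ MonHomOn M' M ξ' ∧
    (∀ f ∈ M, ξ' (ξ f) = f) ∧ (∀ h ∈ M', ξ (ξ' h) = h)

open Filter in
/-- Agreement on finite sets gives a base of the uniformity of pointwise convergence. -/
theorem funUnif_hasBasis (I X : Type*) :
    (@uniformity _ (funUnif I X)).HasBasis (fun J : Set I => J.Finite)
      (fun J => {p | ∀ i ∈ J, p.1 i = p.2 i}) := by
  have h : @uniformity _ (funUnif I X) =
      ⨅ i, 𝓟 {p : (I → X) × (I → X) | p.1 i = p.2 i} := by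
    unfold funUnif
    rw [@Pi.uniformity I (fun _ => X) (fun _ => ⊥)]
    refine iInf_congr fun i => ?_
    rw [bot_uniformity, comap_principal]
    congr 1
  rw [h]
  convert hasBasis_iInf_principal_finite
    (fun i => {p : (I → X) × (I → X) | p.1 i = p.2 i}) using 2 with J
  ext p
  simp

/-- The functions agreeing with `f` on a finite set form a neighbourhood base at `f`. -/
theorem funTop_nhds_hasBasis {I X : Type*} (f : I → X) :
    (@nhds _ (funTop I X) f).HasBasis (fun J : Set I => J.Finite)
      (fun J => {g | ∀ i ∈ J, f i = g i}) :=
  @nhds_basis_uniformity' _ _ (funUnif I X) _ _ (funUnif_hasBasis I X) f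

theorem mem_fClosure_iff {I X : Type*} {S : Set (I → X)} {f : I → X} :
    f ∈ fClosure S ↔ ∀ J : Set I, J.Finite → ∃ g ∈ S, ∀ i ∈ J, f i = g i :=
  letI := funTop I X
  mem_closure_iff_nhds_basis (funTop_nhds_hasBasis f)

theorem fContinuousOn.exists_finite {I X J Y : Type*} {ξ : (I → X) → (J → Y)}
    {S : Set (I → X)} (h : fContinuousOn ξ S) {f : I → X} (hf : f ∈ S)
    {K : Set J} (hK : K.Finite) :
    ∃ L : Set I, L.Finite ∧ ∀ g ∈ S, (∀ i ∈ L, f i = g i) → ∀ j ∈ K, ξ f j = ξ g j := by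
  obtain ⟨L, hL, hLS⟩ := (((funTop_nhds_hasBasis f).inf_principal S).tendsto_iff
    (funTop_nhds_hasBasis (ξ f))).1 (h f hf) K hK
  exact ⟨L, hL, fun g hg hfg => hLS g ⟨hfg, hg⟩⟩

theorem fUniformContinuousOn_iff {I X J Y : Type*} {ξ : (I → X) → (J → Y)}
    {S : Set (I → X)} :
    fUniformContinuousOn ξ S ↔ ∀ K : Set J, K.Finite → ∃ L : Set I, L.Finite ∧
      ∀ f ∈ S, ∀ g ∈ S, (∀ i ∈ L, f i = g i) → ∀ j ∈ K, ξ f j = ξ g j := by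
  refine (((funUnif_hasBasis I X).inf_principal (S ×ˢ S)).tendsto_iff
    (funUnif_hasBasis J Y)).trans ?_
  refine forall₂_congr fun K _ => exists_congr fun L => and_congr_right fun _ => ?_
  exact ⟨fun h f hf g hg hfg => h (f, g) ⟨hfg, hf, hg⟩,
    fun h p hp => h p.1 hp.2.1 p.2 hp.2.2 hp.1⟩

/-- If a transformation monoid `M` has a dense subset `G` of
invertible elements, then every continuous monoid homomorphism `ξ : M → M'`
is uniformly continuous. -/
theorem continuous_monHom_uniformContinuous
    {A B : Type*} (M : Set (A → A)) (M' : Set (B → B)) (G : Set (A → A))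
    (hM : IsTransMonoid M) (hM' : IsTransMonoid M')
    (hGinv : G ⊆ invertibles M) (hdense : M ⊆ fClosure G)
    (ξ : (A → A) → (B → B)) (hhom : MonHomOn M M' ξ)
    (hcont : fContinuousOn ξ M) :
    fUniformContinuousOn ξ M := by
  obtain ⟨-, hid, hmul⟩ := hhom
  rw [fUniformContinuousOn_iff]
  intro K hK
  obtain ⟨L, hL, hLid⟩ := hcont.exists_finite hM.1 hK
  have approx : ∀ f ∈ M, ∃ g ∈ G, (∀ i ∈ L, f i = g i) ∧ ∀ j ∈ K, ξ f j = ξ g j := by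
    intro f hf
    obtain ⟨N, hN, hNf⟩ := hcont.exists_finite hf hK
    obtain ⟨g, hg, hfg⟩ := mem_fClosure_iff.1 (hdense hf) (L ∪ N) (hL.union hN)
    exact ⟨g, hg, fun i hi => hfg i (Or.inl hi),
      hNf g (hGinv hg).1 fun i hi => hfg i (Or.inr hi)⟩
  refine ⟨L, hL, fun f hf g hg hfg j hj => ?_⟩
  obtain ⟨f₀, hf₀, hfL, hfK⟩ := approx f hf
  obtain ⟨g₀, hg₀, hgL, hgK⟩ := approx g hg
  obtain ⟨hf₀M, e, he, hef, hfe⟩ := hGinv hf₀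
  have heg : e ∘ g₀ ∈ M := hM.2 e he g₀ (hGinv hg₀).1
  have hfix : ∀ i ∈ L, id i = (e ∘ g₀) i := fun i hi => by
    rw [comp_apply, ← hgL i hi, ← hfg i hi, hfL i hi]
    exact (congrFun hef i).symm
  have hj' := hLid _ heg hfix j hj
  have hg₀' : ξ g₀ = ξ f₀ ∘ ξ (e ∘ g₀) := by
    rw [← hmul f₀ hf₀M _ heg, ← comp_assoc, hfe, id_comp]
  rw [hfK j hj, hgK j hj, hg₀', comp_apply, ← hj', hid, id]
end

section
/- Let M ⊆ A → A be a closed transformation monoid whose set G of invertible elements is dense in M, and let 𝒦 be a class of closed transformation monoids. Suppose that for every set B of the same cardinality as A and every closed transformation monoid M' ⊆ B → B with M' ∈ 𝒦, every monoid isomorphism θ: M → M' is continuous. Then the following holds: for every set B of the same cardinality as A, all transformation monoids M₁ ⊆ M₂ ⊆ B → B with M₁, M₂ ∈ 𝒦, and all monoid isomorphisms φ₁: M → M₁ and φ₂: M → M₂, if φ₁ and φ₂ agree on G then M₁ = M₂ and φ₁ = φ₂. -/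
open Set Function

universe u

theorem eqOn_of_fContinuousOn_of_subset_fClosure {I X J Y : Type*} {S T : Set (I → X)}
    {ξ η : (I → X) → (J → Y)} (hTS : T ⊆ S) (hdense : S ⊆ fClosure T)
    (hξ : fContinuousOn ξ S) (hη : fContinuousOn η S) (h : EqOn ξ η T) : EqOn ξ η S := by
  let : TopologicalSpace (I → X) := funTop I X
  let : TopologicalSpace Y := ⊥
  have : DiscreteTopology Y := ⟨rfl⟩
  have htop : funTop J Y = Pi.topologicalSpace := rfl
  unfold fContinuousOn at hξ hη
  rw [htop] at hξ hη
  exact h.of_subset_closure hξ hη hTS hdense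

/-- If every monoid isomorphism from the closed monoid `M`
(with dense group of invertibles) onto a member of the class `𝒦` of closed
transformation monoids is continuous, then two isomorphisms onto nested
members of `𝒦` agreeing on the invertibles agree everywhere (and the members
coincide). -/
theorem continuity_implies_group_extension_property
    {A : Type u} (M : Set (A → A)) (hM : IsTransMonoid M) (hMclosed : fIsClosed M)
    (hdense : M ⊆ fClosure (invertibles M))
    (𝒦 : ∀ B : Type u, Set (Set (B → B)))
    (h𝒦 : ∀ (B : Type u), ∀ M' ∈ 𝒦 B, IsTransMonoid M' ∧ fIsClosed M')
    (hcont : ∀ (B : Type u), Nonempty (A ≃ B) → ∀ M' ∈ 𝒦 B,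
      ∀ (θ : (A → A) → (B → B)) (θ' : (B → B) → (A → A)),
        MonIsoOn M M' θ θ' → fContinuousOn θ M) :
    ∀ (B : Type u), Nonempty (A ≃ B) → ∀ M₁ M₂ : Set (B → B),
      M₁ ∈ 𝒦 B → M₂ ∈ 𝒦 B → M₁ ⊆ M₂ →
      ∀ (φ₁ : (A → A) → (B → B)) (φ₁' : (B → B) → (A → A))
        (φ₂ : (A → A) → (B → B)) (φ₂' : (B → B) → (A → A)),
        MonIsoOn M M₁ φ₁ φ₁' → MonIsoOn M M₂ φ₂ φ₂' →
        (∀ g ∈ invertibles M, φ₁ g = φ₂ g) →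
        M₁ = M₂ ∧ ∀ f ∈ M, φ₁ f = φ₂ f := by
  intro B hB M₁ M₂ hM₁ hM₂ hsub φ₁ φ₁' φ₂ φ₂' h₁ h₂ hagree
  have heq : EqOn φ₁ φ₂ M := eqOn_of_fContinuousOn_of_subset_fClosure (fun _ hg => hg.1) hdense
    (hcont B hB M₁ hM₁ φ₁ φ₁' h₁) (hcont B hB M₂ hM₂ φ₂ φ₂' h₂) hagree
  obtain ⟨⟨hmaps₁, -⟩, -⟩ := h₁
  obtain ⟨-, ⟨hmaps₂', -⟩, -, hright₂⟩ := h₂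
  refine ⟨hsub.antisymm fun h hh => ?_, heq⟩
  rw [← hright₂ h hh, ← heq (hmaps₂' hh)]
  exact hmaps₁ (hmaps₂' hh)
end

section
/- Let M ⊆ A → A be a transformation monoid, G ⊆ M a subset, and 𝒦 a class of transformation monoids containing {ψ(M) : ψ ∈ E_G}. Then E_G = {id_M} holds if and only if the following condition holds: for every set B of the same cardinality as A, all transformation monoids M₁ ⊆ M₂ ⊆ B → B with M₁, M₂ ∈ 𝒦, and all monoid isomorphisms φ₁: M → M₁ and φ₂: M → M₂, if φ₁ and φ₂ agree on G then M₁ = M₂ and φ₁ = φ₂. -/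
open Set Function

universe u

theorem MonHomOn.comp {A B C : Type*} {M : Set (A → A)} {N : Set (B → B)} {P : Set (C → C)}
    {η : (B → B) → (C → C)} {ξ : (A → A) → (B → B)}
    (hη : MonHomOn N P η) (hξ : MonHomOn M N ξ) : MonHomOn M P (η ∘ ξ) := by
  refine ⟨hη.1.comp hξ.1, ?_, fun f hf g hg => ?_⟩
  · rw [comp_apply, hξ.2.1, hη.2.1]
  · simp only [comp_apply, hξ.2.2 f hf g hg, hη.2.2 _ (hξ.1 hf) _ (hξ.1 hg)]

theorem monHomOn_id {A : Type*} (M : Set (A → A)) : MonHomOn M M id :=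
  ⟨mapsTo_id M, rfl, fun _ _ _ _ => rfl⟩

theorem monIsoOn_id {A : Type*} (M : Set (A → A)) : MonIsoOn M M id id :=
  ⟨monHomOn_id M, monHomOn_id M, fun _ _ => rfl, fun _ _ => rfl⟩

/-- An injective monoid homomorphism is an isomorphism onto its image. -/
theorem MonHomOn.monIsoOn_image {A B : Type*} {M : Set (A → A)} {N : Set (B → B)}
    {ξ : (A → A) → (B → B)} (hM : IsTransMonoid M) (hξ : MonHomOn M N ξ) (hinj : InjOn ξ M) :
    ∃ ξ', MonIsoOn M (ξ '' M) ξ ξ' := by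
  have : Nonempty (A → A) := ⟨id⟩
  have hleft : ∀ f ∈ M, invFunOn ξ M (ξ f) = f := fun f hf => hinj.leftInvOn_invFunOn hf
  refine ⟨invFunOn ξ M, ⟨mapsTo_image ξ M, hξ.2⟩, ⟨?_, ?_, ?_⟩, hleft, ?_⟩
  · rintro _ ⟨f, hf, rfl⟩
    rwa [hleft f hf]
  · simpa only [hξ.2.1] using hleft id hM.1
  · rintro _ ⟨f, hf, rfl⟩ _ ⟨g, hg, rfl⟩
    rw [← hξ.2.2 f hf g hg, hleft _ (hM.2 f hf g hg), hleft f hf, hleft g hg]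
  · rintro _ ⟨f, hf, rfl⟩
    rw [hleft f hf]

/-- For a class `𝒦` containing all images `ψ(M)` for
injective monoid endomorphisms `ψ` of `M` fixing `G` pointwise, the condition
`E_G = {id}` is equivalent to the group-extension property w.r.t. `𝒦`. -/
theorem EG_trivial_iff_group_extension
    {A : Type u} (M : Set (A → A)) (hM : IsTransMonoid M)
    (G : Set (A → A)) (hGM : G ⊆ M)
    (𝒦 : ∀ B : Type u, Set (Set (B → B)))
    (h𝒦 : ∀ (B : Type u), ∀ M' ∈ 𝒦 B, IsTransMonoid M')
    (him : ∀ ψ : (A → A) → (A → A), MonHomOn M M ψ → Set.InjOn ψ M →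
      (∀ g ∈ G, ψ g = g) → ψ '' M ∈ 𝒦 A) :
    (∀ ψ : (A → A) → (A → A), MonHomOn M M ψ → Set.InjOn ψ M →
        (∀ g ∈ G, ψ g = g) → ∀ f ∈ M, ψ f = f) ↔
      (∀ (B : Type u), Nonempty (A ≃ B) → ∀ M₁ M₂ : Set (B → B),
        M₁ ∈ 𝒦 B → M₂ ∈ 𝒦 B → M₁ ⊆ M₂ →
        ∀ (φ₁ : (A → A) → (B → B)) (φ₁' : (B → B) → (A → A))
          (φ₂ : (A → A) → (B → B)) (φ₂' : (B → B) → (A → A)),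
          MonIsoOn M M₁ φ₁ φ₁' → MonIsoOn M M₂ φ₂ φ₂' →
          (∀ g ∈ G, φ₁ g = φ₂ g) →
          M₁ = M₂ ∧ ∀ f ∈ M, φ₁ f = φ₂ f) := by
  constructor
  · rintro hE B - M₁ M₂ - - hsub φ₁ φ₁' φ₂ φ₂' h₁ h₂ hG
    have hfix : ∀ f ∈ M, φ₂' (φ₁ f) = f := by
      refine hE (φ₂' ∘ φ₁) (h₂.2.1.comp ⟨h₁.1.1.mono_right hsub, h₁.1.2⟩) ?_ fun g hg => ?_
      · intro f hf g hg hfg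
        have h : φ₁ f = φ₁ g := by
          rw [← h₂.2.2.2 _ (hsub (h₁.1.1 hf)), ← h₂.2.2.2 _ (hsub (h₁.1.1 hg))]
          exact congrArg φ₂ hfg
        rw [← h₁.2.2.1 f hf, h, h₁.2.2.1 g hg]
      · rw [comp_apply, hG g hg, h₂.2.2.1 g (hGM hg)]
    have heq : ∀ f ∈ M, φ₁ f = φ₂ f := fun f hf => by
      rw [← h₂.2.2.2 _ (hsub (h₁.1.1 hf)), hfix f hf]
    refine ⟨hsub.antisymm fun h hh => ?_, heq⟩
    rw [← h₂.2.2.2 h hh, ← heq _ (h₂.2.1.1 hh)]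
    exact h₁.1.1 (h₂.2.1.1 hh)
  · intro hext ψ hψ hinj hG
    have hMK : M ∈ 𝒦 A := by
      simpa using him id (monHomOn_id M) (injOn_id M) fun _ _ => rfl
    obtain ⟨ψ', hψ'⟩ := hψ.monIsoOn_image hM hinj
    exact (hext A ⟨Equiv.refl A⟩ (ψ '' M) M (him ψ hψ hinj hG) hMK hψ.1.image_subset
      ψ ψ' id id hψ' (monIsoOn_id M) hG).2
end

section
/- Assume M ⊆ A → A and M' ⊆ B → B are closed transformation monoids with sets G ⊆ M and G' ⊆ M' of invertible elements, and that G is dense in M. Let φ: M → M' be a monoid isomorphism. Suppose (i) for every monoid isomorphism ψ: M → cl(G') onto the closure of G' in B → B, if ψ and φ agree on G then ψ(f) = φ(f) for all f ∈ M; and (ii) there is a bijection θ: A → B such that φ(g) = θ∘g∘θ⁻¹ for all g ∈ G. Then φ(f) = θ∘f∘θ⁻¹ for all f ∈ M, i.e. φ is induced by conjugation by the same bijection θ. -/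
open Set Function

universe u

/-- Conjugation by a bijection is continuous for pointwise convergence. -/
theorem continuous_conj {A B : Type*} (θ : A ≃ B) :
    @Continuous _ _ (funTop A A) (funTop B B) (fun f => ⇑θ ∘ f ∘ ⇑θ.symm) := by
  let _ : UniformSpace A := ⊥
  let _ : UniformSpace B := ⊥
  have : DiscreteTopology A := ⟨rfl⟩
  change Continuous (fun (f : A → A) (b : B) => θ (f (θ.symm b)))
  exact continuous_pi fun b => continuous_of_discreteTopology.comp (continuous_apply _)

/-- Conjugation sends the closure of `S` into that of `T` when it sends `S` into `T`. -/
theorem mapsTo_conj_fClosure {A B : Type*} (θ : A ≃ B) {S : Set (A → A)} {T : Set (B → B)}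
    (h : MapsTo (fun f : A → A => ⇑θ ∘ f ∘ ⇑θ.symm) S T) :
    MapsTo (fun f : A → A => ⇑θ ∘ f ∘ ⇑θ.symm) (fClosure S) (fClosure T) := by
  let _ := funTop A A
  let _ := funTop B B
  exact h.closure (continuous_conj θ)

/-- A monoid homomorphism preserves invertible elements. -/
theorem MonHomOn.mapsTo_invertibles {A B : Type*} {M : Set (A → A)} {M' : Set (B → B)}
    {ξ : (A → A) → (B → B)} (h : MonHomOn M M' ξ) :
    MapsTo ξ (invertibles M) (invertibles M') := by
  obtain ⟨hmaps, hid, hcomp⟩ := h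
  rintro g ⟨hg, f, hf, hfg, hgf⟩
  exact ⟨hmaps hg, ξ f, hmaps hf, by rw [← hcomp f hf g hg, hfg, hid],
    by rw [← hcomp g hg f hf, hgf, hid]⟩

/-- Lifting conjugation from the dense group of invertibles
to the whole monoid isomorphism. -/
theorem conjugation_lifts_from_group_to_monoid
    {A B : Type*} (M : Set (A → A)) (M' : Set (B → B))
    (hM : IsTransMonoid M) (hM' : IsTransMonoid M')
    (hMclosed : fIsClosed M) (hM'closed : fIsClosed M')
    (hdense : M ⊆ fClosure (invertibles M))
    (φ : (A → A) → (B → B)) (φ' : (B → B) → (A → A))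
    (hφ : MonIsoOn M M' φ φ')
    (hi : ∀ (ψ : (A → A) → (B → B)) (ψ' : (B → B) → (A → A)),
      MonIsoOn M (fClosure (invertibles M')) ψ ψ' →
      (∀ g ∈ invertibles M, ψ g = φ g) → ∀ f ∈ M, ψ f = φ f)
    (θ : A ≃ B)
    (hconjG : ∀ g ∈ invertibles M, φ g = ⇑θ ∘ g ∘ ⇑θ.symm) :
    ∀ f ∈ M, φ f = ⇑θ ∘ f ∘ ⇑θ.symm := by
  obtain ⟨hφhom, hφ'hom, -, hright⟩ := hφ
  have hmaps : MapsTo (fun f : A → A => ⇑θ ∘ f ∘ ⇑θ.symm) (invertibles M) (invertibles M') := by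
    intro g hg
    simpa only [hconjG g hg] using hφhom.mapsTo_invertibles hg
  have hmaps' : MapsTo (fun h : B → B => ⇑θ.symm ∘ h ∘ ⇑θ) (invertibles M') M := by
    intro h hh
    have hg := hφ'hom.mapsTo_invertibles hh
    have heq : h = ⇑θ ∘ φ' h ∘ ⇑θ.symm := by rw [← hconjG _ hg, hright h hh.1]
    have : ⇑θ.symm ∘ h ∘ ⇑θ = φ' h := by
      conv_lhs => rw [heq]
      funext x
      simp
    simpa only [this] using hg.1
  have hMcl : fClosure M = M := by
    let _ := funTop A A
    exact IsClosed.closure_eq hMclosed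
  have hmapsCl' := mapsTo_conj_fClosure θ.symm hmaps'
  rw [hMcl] at hmapsCl'
  have hiso : MonIsoOn M (fClosure (invertibles M'))
      (fun f => ⇑θ ∘ f ∘ ⇑θ.symm) (fun h => ⇑θ.symm ∘ h ∘ ⇑θ) := by
    refine ⟨⟨(mapsTo_conj_fClosure θ hmaps).mono_left hdense, ?_, ?_⟩,
      ⟨hmapsCl', ?_, ?_⟩, ?_, ?_⟩ <;> intros <;> funext x <;> simp
  exact fun f hf => (hi _ _ hiso (fun g hg => (hconjG g hg).symm) f hf).symm
end

section
/- Let 𝒦 be a class of closed transformation monoids, let 𝒢 = {G(M') : M' ∈ 𝒦} be the class of groups of invertible elements of members of 𝒦, and assume that the closure (in the full function monoid) of every member of 𝒢 belongs to 𝒦. Let M ⊆ A → A be a closed transformation monoid with automatic homeomorphicity with respect to 𝒦 whose group G = G(M) of invertible elements is dense in M. If G has automatic action compatibility with respect to 𝒢, then M has automatic action compatibility with respect to 𝒦: for every set B of the same cardinality as A, every M' ∈ 𝒦 on B and every monoid isomorphism φ: M → M', there is a bijection θ: A → B with φ(f) = θ∘f∘θ⁻¹ for all f ∈ M. -/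
open Set Function

universe u

/-- A monoid homomorphism maps invertible elements to invertible elements. -/
theorem MonHomOn.restrict_invertibles {A B : Type*} {M : Set (A → A)} {M' : Set (B → B)}
    {ξ : (A → A) → (B → B)} (h : MonHomOn M M' ξ) :
    MonHomOn (invertibles M) (invertibles M') ξ := by
  obtain ⟨hmaps, hid, hcomp⟩ := h
  refine ⟨?_, hid, fun f hf g hg => hcomp f hf.1 g hg.1⟩
  rintro g ⟨hg, f, hf, hfg, hgf⟩
  refine ⟨hmaps hg, ξ f, hmaps hf, ?_, ?_⟩
  · rw [← hcomp f hf g hg, hfg, hid]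
  · rw [← hcomp g hg f hf, hgf, hid]

/-- A monoid isomorphism restricts to an isomorphism of the groups of invertible elements. -/
theorem MonIsoOn.restrict_invertibles {A B : Type*} {M : Set (A → A)} {M' : Set (B → B)}
    {ξ : (A → A) → (B → B)} {ξ' : (B → B) → (A → A)} (h : MonIsoOn M M' ξ ξ') :
    MonIsoOn (invertibles M) (invertibles M') ξ ξ' :=
  ⟨h.1.restrict_invertibles, h.2.1.restrict_invertibles,
    fun f hf => h.2.2.1 f hf.1, fun f hf => h.2.2.2 f hf.1⟩

/-- The topology of pointwise convergence is Hausdorff. -/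
theorem t2Space_funTop (I X : Type*) : @T2Space (I → X) (funTop I X) := by
  let : TopologicalSpace X := ⊥
  have : DiscreteTopology X := ⟨rfl⟩
  exact (inferInstance : T2Space (I → X))

/-- Conjugation by a bijection is continuous for pointwise convergence. -/
theorem fContinuousOn_conj {A B : Type*} (θ : A ≃ B) (S : Set (A → A)) :
    fContinuousOn (fun f => ⇑θ ∘ f ∘ ⇑θ.symm) S := by
  let : TopologicalSpace A := ⊥
  let : TopologicalSpace B := ⊥
  have : DiscreteTopology A := ⟨rfl⟩
  have h : Continuous fun f : A → A => ⇑θ ∘ f ∘ ⇑θ.symm :=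
    continuous_pi fun b => continuous_of_discreteTopology.comp (continuous_apply (θ.symm b))
  exact h.continuousOn

/-- Two continuous maps that agree on a dense subset of `T` agree on `T`. -/
theorem eqOn_of_fContinuousOn {I X J Y : Type*} {ξ η : (I → X) → (J → Y)} {S T : Set (I → X)}
    (h : Set.EqOn ξ η S) (hξ : fContinuousOn ξ T) (hη : fContinuousOn η T)
    (hST : S ⊆ T) (hTS : T ⊆ fClosure S) : Set.EqOn ξ η T := by
  let := funTop I X
  let := funTop J Y
  have := t2Space_funTop J Y
  exact h.of_subset_closure hξ hη hST hTS

/-- Transfer of automatic action compatibility from the dense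
group of invertibles to the closed monoid, given automatic homeomorphicity of
the monoid w.r.t. the class `𝒦`. -/
theorem transfer_automatic_action_compatibility
    {A : Type u}
    (𝒦 : ∀ B : Type u, Set (Set (B → B)))
    (h𝒦 : ∀ (B : Type u), ∀ M' ∈ 𝒦 B, IsTransMonoid M' ∧ fIsClosed M')
    (h𝒦cl : ∀ (B : Type u), ∀ M' ∈ 𝒦 B, fClosure (invertibles M') ∈ 𝒦 B)
    (M : Set (A → A)) (hM : IsTransMonoid M) (hMclosed : fIsClosed M)
    (hdense : M ⊆ fClosure (invertibles M))
    (hMah : ∀ (B : Type u), Nonempty (A ≃ B) → ∀ M' ∈ 𝒦 B,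
      ∀ (φ : (A → A) → (B → B)) (φ' : (B → B) → (A → A)),
        MonIsoOn M M' φ φ' → fContinuousOn φ M ∧ fContinuousOn φ' M')
    (hGaac : ∀ (B : Type u), Nonempty (A ≃ B) → ∀ M'' ∈ 𝒦 B,
      ∀ (ξ : (A → A) → (B → B)) (ξ' : (B → B) → (A → A)),
        MonIsoOn (invertibles M) (invertibles M'') ξ ξ' →
        ∃ θ : A ≃ B, ∀ g ∈ invertibles M, ξ g = ⇑θ ∘ g ∘ ⇑θ.symm) :
    ∀ (B : Type u), Nonempty (A ≃ B) → ∀ M' ∈ 𝒦 B,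
      ∀ (φ : (A → A) → (B → B)) (φ' : (B → B) → (A → A)),
        MonIsoOn M M' φ φ' →
        ∃ θ : A ≃ B, ∀ f ∈ M, φ f = ⇑θ ∘ f ∘ ⇑θ.symm := by
  intro B hAB M' hM' φ φ' hφ
  obtain ⟨θ, hθ⟩ := hGaac B hAB M' hM' φ φ' hφ.restrict_invertibles
  exact ⟨θ, eqOn_of_fContinuousOn hθ (hMah B hAB M' hM' φ φ' hφ).1
    (fContinuousOn_conj θ M) (fun _ hg => hg.1) hdense⟩
end

section
/- Let F be a clone on a set A and F' a clone on a set B such that the unary part F⁽¹⁾ of F is weakly directed, and let ξ: F → F' be a surjective clone homomorphism whose restriction to the unary parts is given by conjugation with a bijection θ: A → B, i.e. ξ(f) = θ∘f∘θ⁻¹ for all f ∈ F⁽¹⁾. Then for every n ∈ ℕ and every n-ary h ∈ F, ξ(h) = θ∘h∘(θ⁻¹×⋯×θ⁻¹), i.e. ξ(h)(y₁,…,yₙ) = θ(h(θ⁻¹(y₁),…,θ⁻¹(yₙ))) for all y₁,…,yₙ ∈ B; in particular, ξ is a clone isomorphism and a uniform homeomorphism. -/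
open Set Function

universe u

/-- A clone on `A`: a family of sets of finitary operations containing all
projections and closed under composition. -/
def IsClone {A : Type*} (F : ∀ n : ℕ, Set ((Fin n → A) → A)) : Prop :=
  (∀ (n : ℕ) (i : Fin n), (fun x : Fin n → A => x i) ∈ F n) ∧
  (∀ (n m : ℕ), ∀ f ∈ F n, ∀ g : Fin n → ((Fin m → A) → A), (∀ i, g i ∈ F m) →
    (fun x : Fin m → A => f (fun i => g i x)) ∈ F m)

/-- A clone homomorphism from `F` to `F'`: an arity-preserving map sending
projections to projections and compatible with composition, given as a family
of total maps on operations. -/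
def CloneHomOn {A B : Type*} (F : ∀ n : ℕ, Set ((Fin n → A) → A))
    (F' : ∀ n : ℕ, Set ((Fin n → B) → B))
    (ξ : ∀ n : ℕ, ((Fin n → A) → A) → ((Fin n → B) → B)) : Prop :=
  (∀ n, Set.MapsTo (ξ n) (F n) (F' n)) ∧
  (∀ (n : ℕ) (i : Fin n), ξ n (fun x => x i) = fun x => x i) ∧
  (∀ (n m : ℕ), ∀ f ∈ F n, ∀ g : Fin n → ((Fin m → A) → A), (∀ i, g i ∈ F m) →
    ξ m (fun x => f (fun i => g i x)) = fun x => ξ n f (fun i => ξ m (g i) x))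

/-- Reindexing the arguments and relabelling the values of functions is uniformly continuous
for the uniformities of pointwise convergence. -/
theorem fUniformContinuousOn_of_forall_eq {I X J Y : Type*} {S : Set (I → X)}
    {ξ : (I → X) → (J → Y)} (σ : X → Y) (τ : J → I)
    (h : ∀ f ∈ S, ∀ j, ξ f j = σ (f (τ j))) : fUniformContinuousOn ξ S := by
  let uX : UniformSpace X := ⊥
  let uY : UniformSpace Y := ⊥
  have hσ : UniformContinuous σ := by
    rw [uniformContinuous_iff_le_comap]
    exact bot_le
  have hc : UniformContinuous (fun (f : I → X) (j : J) => σ (f (τ j))) :=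
    uniformContinuous_pi.2 fun j => hσ.comp (Pi.uniformContinuous_proj (fun _ : I => X) (τ j))
  refine Filter.Tendsto.congr' ?_ (hc.uniformContinuousOn (s := S))
  refine Filter.mem_inf_of_right (Filter.mem_principal.2 ?_)
  rintro ⟨f, g⟩ ⟨hf, hg⟩
  exact Prod.ext (funext fun j => (h f hf j).symm) (funext fun j => (h g hg j).symm)

/-- In a clone whose unary part is weakly directed, every finite tuple is the image of a single
element under unary operations. -/
theorem IsClone.exists_unary_tuple {A : Type*} [Nonempty A] {F : ∀ n : ℕ, Set ((Fin n → A) → A)}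
    (hF : IsClone F)
    (hwd : ∀ a b : A, ∃ f ∈ F 1, ∃ g ∈ F 1, ∃ c : A,
      f (fun _ => c) = a ∧ g (fun _ => c) = b) {n : ℕ} (x : Fin n → A) :
    ∃ (c : A) (f : Fin n → ((Fin 1 → A) → A)), (∀ i, f i ∈ F 1) ∧
      ∀ i, f i (fun _ => c) = x i := by
  induction n with
  | zero => exact ⟨Classical.arbitrary A, fun i => i.elim0, fun i => i.elim0, fun i => i.elim0⟩
  | succ n ih =>
    obtain ⟨c, f, hf, hfc⟩ := ih (fun i => x i.succ)
    obtain ⟨p, hp, q, hq, d, hpd, hqd⟩ := hwd (x 0) c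
    refine ⟨d, Fin.cons p fun i z => f i fun _ => q z, ?_, ?_⟩
    · refine Fin.cases hp fun i => ?_
      exact hF.2 1 1 (f i) (hf i) (fun _ => q) fun _ => hq
    · refine Fin.cases hpd fun i => ?_
      simp only [Fin.cons_succ, hqd, hfc]

/-- A surjective clone homomorphism whose unary restriction
is induced by conjugation with a bijection `θ`, from a clone with weakly
directed unary part, is induced by conjugation with `θ` on all arities; in
particular it is a clone isomorphism and a uniform homeomorphism. -/
theorem clone_hom_conjugation_lifts
    {A B : Type*} (F : ∀ n : ℕ, Set ((Fin n → A) → A))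
    (F' : ∀ n : ℕ, Set ((Fin n → B) → B))
    (hF : IsClone F) (hF' : IsClone F')
    (hwd : ∀ a b : A, ∃ f ∈ F 1, ∃ g ∈ F 1, ∃ c : A,
      f (fun _ => c) = a ∧ g (fun _ => c) = b)
    (ξ : ∀ n : ℕ, ((Fin n → A) → A) → ((Fin n → B) → B))
    (hhom : CloneHomOn F F' ξ)
    (hsurj : ∀ n, Set.SurjOn (ξ n) (F n) (F' n))
    (θ : A ≃ B)
    (hconj1 : ∀ f ∈ F 1, ∀ y : Fin 1 → B, ξ 1 f y = θ (f (fun i => θ.symm (y i)))) :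
    (∀ (n : ℕ), ∀ h ∈ F n, ∀ y : Fin n → B, ξ n h y = θ (h (fun i => θ.symm (y i)))) ∧
    ∃ ξ' : ∀ n : ℕ, ((Fin n → B) → B) → ((Fin n → A) → A),
      CloneHomOn F' F ξ' ∧
      (∀ n, ∀ f ∈ F n, ξ' n (ξ n f) = f) ∧
      (∀ n, ∀ h ∈ F' n, ξ n (ξ' n h) = h) ∧
      (∀ n, fUniformContinuousOn (ξ n) (F n)) ∧
      (∀ n, fUniformContinuousOn (ξ' n) (F' n)) := by
  have key : ∀ (n : ℕ), ∀ h ∈ F n, ∀ y : Fin n → B,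
      ξ n h y = θ (h (fun i => θ.symm (y i))) := by
    intro n h hh y
    have : Nonempty A := ⟨h fun i => θ.symm (y i)⟩
    obtain ⟨c, f, hf, hfc⟩ := hF.exists_unary_tuple hwd fun i => θ.symm (y i)
    have hcomp := congrFun (hhom.2.2 n 1 h hh f hf) fun _ => θ c
    rw [hconj1 _ (hF.2 n 1 h hh f hf)] at hcomp
    simpa [hconj1 _ (hf _), hfc] using hcomp.symm
  have hinv : ∀ n, ∀ f ∈ F n, (fun x => θ.symm (ξ n f fun i => θ (x i))) = f := by
    intro n f hf
    funext x
    simp [key n f hf]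
  refine ⟨key, fun n g x => θ.symm (g fun i => θ (x i)), ⟨?_, ?_, ?_⟩, hinv, ?_, ?_, ?_⟩
  · intro n g hg
    obtain ⟨f, hf, rfl⟩ := hsurj n hg
    simpa only [hinv n f hf] using hf
  · intro n i
    simp
  · intro n m f _ g _
    simp
  · intro n g hg
    obtain ⟨f, hf, rfl⟩ := hsurj n hg
    exact congrArg (ξ n) (hinv n f hf)
  · exact fun n => fUniformContinuousOn_of_forall_eq θ (fun y i => θ.symm (y i)) (key n)
  · exact fun n => fUniformContinuousOn_of_forall_eq θ.symm (fun x i => θ (x i))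
      fun _ _ _ => rfl
end

section
/- Let 𝒦 be a class of transformation monoids and 𝒞 a class of clones such that the unary part of every member of 𝒞 belongs to 𝒦. Let F be a clone on a set A whose unary part F⁽¹⁾ is weakly directed and has automatic action compatibility with respect to 𝒦. Then F has automatic action compatibility with respect to 𝒞: for every set B of the same cardinality as A, every clone F' ∈ 𝒞 on B and every clone isomorphism ξ: F → F', there is a bijection θ: A → B with ξ(h) = θ∘h∘(θ⁻¹×⋯×θ⁻¹) for every n and every n-ary h ∈ F; in particular ξ is a uniform homeomorphism. -/
open Set Function

universe u

/-- The self-map of `A` corresponding to a unary operation. -/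
def unaryToFun {A : Type*} (o : (Fin 1 → A) → A) : A → A := fun a => o fun _ => a

/-- The unary part of a clone, viewed as a set of self-maps of the carrier. -/
def unaryPart {A : Type*} (F : ∀ n : ℕ, Set ((Fin n → A) → A)) : Set (A → A) :=
  unaryToFun '' F 1

/-- The unary operation corresponding to a self-map of `A`; inverse to `unaryToFun`. -/
def funToUnary {A : Type*} (f : A → A) : (Fin 1 → A) → A := fun x => f (x 0)

@[simp]
theorem unaryToFun_funToUnary {A : Type*} (f : A → A) : unaryToFun (funToUnary f) = f := rfl

@[simp]
theorem funToUnary_unaryToFun {A : Type*} (o : (Fin 1 → A) → A) :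
    funToUnary (unaryToFun o) = o := by
  funext x
  exact congrArg o (funext fun i => by rw [Subsingleton.elim i 0])

theorem mem_unaryPart {A : Type*} {F : ∀ n : ℕ, Set ((Fin n → A) → A)} {f : A → A} :
    f ∈ unaryPart F ↔ funToUnary f ∈ F 1 := by
  constructor
  · rintro ⟨o, ho, rfl⟩
    simpa using ho
  · exact fun h => ⟨_, h, rfl⟩

/-- The map on self-maps given by the action of `ξ` on unary operations. -/
def unaryMap {A B : Type*} (ξ : ∀ n : ℕ, ((Fin n → A) → A) → ((Fin n → B) → B))
    (f : A → A) : B → B :=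
  unaryToFun (ξ 1 (funToUnary f))

/-- A clone homomorphism restricts to a monoid homomorphism between the unary parts. -/
theorem CloneHomOn.monHomOn {A B : Type*} {F : ∀ n : ℕ, Set ((Fin n → A) → A)}
    {F' : ∀ n : ℕ, Set ((Fin n → B) → B)}
    {ξ : ∀ n : ℕ, ((Fin n → A) → A) → ((Fin n → B) → B)} (h : CloneHomOn F F' ξ) :
    MonHomOn (unaryPart F) (unaryPart F') (unaryMap ξ) := by
  obtain ⟨hmaps, hproj, hcomp⟩ := h
  refine ⟨fun f hf => ⟨_, hmaps 1 (mem_unaryPart.1 hf), rfl⟩, ?_, fun f hf g hg => ?_⟩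
  · exact congrArg unaryToFun (hproj 1 0)
  · exact congrArg unaryToFun (hcomp 1 1 _ (mem_unaryPart.1 hf) (fun _ => funToUnary g)
      fun _ => mem_unaryPart.1 hg)

/-- Finitely many points are simultaneously values of members of a weakly directed clone at a
common point. -/
theorem exists_common_preimage {A : Type*} [Nonempty A] {F : ∀ n : ℕ, Set ((Fin n → A) → A)}
    (hF : IsClone F)
    (hwd : ∀ a b : A, ∃ f ∈ F 1, ∃ g ∈ F 1, ∃ c : A,
      f (fun _ => c) = a ∧ g (fun _ => c) = b) :
    ∀ (n : ℕ) (x : Fin n → A), ∃ (c : A) (f : Fin n → ((Fin 1 → A) → A)),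
      ∀ i, f i ∈ F 1 ∧ f i (fun _ => c) = x i := by
  intro n
  induction n with
  | zero => exact fun _ => ⟨Classical.arbitrary A, Fin.elim0, fun i => i.elim0⟩
  | succ n ih =>
    intro x
    obtain ⟨c, f, hf⟩ := ih (fun i => x i.succ)
    obtain ⟨p, hp, q, hq, d, hpd, hqd⟩ := hwd (x 0) c
    refine ⟨d, Fin.cons p fun i y => f i fun _ => q y, Fin.cases ⟨hp, hpd⟩ fun i => ?_⟩
    refine ⟨hF.2 1 1 _ (hf i).1 (fun _ => q) fun _ => hq, ?_⟩
    simp only [Fin.cons_succ, hqd]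
    exact (hf i).2

/-- A map that agrees on `S` with conjugation by `θ` is uniformly continuous on `S`. -/
theorem fUniformContinuousOn_of_conj {I J X Y : Type*} {S : Set (I → X)}
    {ξ : (I → X) → (J → Y)} (θ : X → Y) (σ : J → I)
    (h : ∀ f ∈ S, ∀ y, ξ f y = θ (f (σ y))) : fUniformContinuousOn ξ S := by
  let _ : UniformSpace X := ⊥
  let _ : UniformSpace Y := ⊥
  have hc : UniformContinuous fun (f : I → X) (y : J) => θ (f (σ y)) :=
    uniformContinuous_pi.2 fun y =>
      (DiscreteUniformity.uniformContinuous X θ).comp (Pi.uniformContinuous_proj _ (σ y))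
  exact hc.uniformContinuousOn.congr fun f hf => funext fun y => (h f hf y).symm

/-- If the unary part of a clone `F` is weakly directed and
has automatic action compatibility w.r.t. a class `𝒦` of transformation
monoids containing the unary parts of all members of a class `𝒞` of clones,
then `F` has automatic action compatibility w.r.t. `𝒞` (and, in particular,
the isomorphisms involved are uniform homeomorphisms). -/
theorem clone_automatic_action_compatibility
    {A : Type u}
    (𝒦 : ∀ B : Type u, Set (Set (B → B)))
    (𝒞 : ∀ B : Type u, Set (∀ n : ℕ, Set ((Fin n → B) → B)))
    (h𝒦mon : ∀ (B : Type u), ∀ M' ∈ 𝒦 B, IsTransMonoid M')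
    (h𝒞clone : ∀ (B : Type u), ∀ F' ∈ 𝒞 B, IsClone F')
    (hunary : ∀ (B : Type u), ∀ F' ∈ 𝒞 B, unaryPart F' ∈ 𝒦 B)
    (F : ∀ n : ℕ, Set ((Fin n → A) → A)) (hF : IsClone F)
    (hwd : ∀ a b : A, ∃ f ∈ F 1, ∃ g ∈ F 1, ∃ c : A,
      f (fun _ => c) = a ∧ g (fun _ => c) = b)
    (haac : ∀ (B : Type u), Nonempty (A ≃ B) → ∀ M' ∈ 𝒦 B,
      ∀ (φ : (A → A) → (B → B)) (φ' : (B → B) → (A → A)),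
        MonIsoOn (unaryPart F) M' φ φ' →
        ∃ θ : A ≃ B, ∀ f ∈ unaryPart F, φ f = ⇑θ ∘ f ∘ ⇑θ.symm) :
    ∀ (B : Type u), Nonempty (A ≃ B) → ∀ F' ∈ 𝒞 B,
      ∀ (ξ : ∀ n : ℕ, ((Fin n → A) → A) → ((Fin n → B) → B))
        (ξ' : ∀ n : ℕ, ((Fin n → B) → B) → ((Fin n → A) → A)),
        CloneHomOn F F' ξ → CloneHomOn F' F ξ' →
        (∀ n, ∀ f ∈ F n, ξ' n (ξ n f) = f) → (∀ n, ∀ h ∈ F' n, ξ n (ξ' n h) = h) →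
        ∃ θ : A ≃ B,
          (∀ (n : ℕ), ∀ h ∈ F n, ∀ y : Fin n → B,
            ξ n h y = θ (h (fun i => θ.symm (y i)))) ∧
          (∀ n, fUniformContinuousOn (ξ n) (F n)) ∧
          (∀ n, fUniformContinuousOn (ξ' n) (F' n)) := by
  intro B hAB F' hF' ξ ξ' hξ hξ' hl hr
  obtain ⟨θ, hθ⟩ := haac B hAB _ (hunary B F' hF') (unaryMap ξ) (unaryMap ξ')
    ⟨hξ.monHomOn, hξ'.monHomOn,
      fun f hf => by simp [unaryMap, hl 1 _ (mem_unaryPart.1 hf)],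
      fun f hf => by simp [unaryMap, hr 1 _ (mem_unaryPart.1 hf)]⟩
  have hunaryConj : ∀ f ∈ F 1, ∀ a, ξ 1 f (fun _ => θ a) = θ (f fun _ => a) := by
    intro f hf a
    have := congrFun (hθ _ ⟨f, hf, rfl⟩) (θ a)
    simpa [unaryMap, unaryToFun] using this
  have hconj : ∀ (n : ℕ), ∀ h ∈ F n, ∀ y : Fin n → B,
      ξ n h y = θ (h (fun i => θ.symm (y i))) := by
    intro n h hh y
    have : Nonempty A := ⟨h fun i => θ.symm (y i)⟩
    obtain ⟨c, f, hf⟩ := exists_common_preimage hF hwd n fun i => θ.symm (y i)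
    have key := hunaryConj _ (hF.2 n 1 h hh f fun i => (hf i).1) c
    rw [hξ.2.2 n 1 h hh f fun i => (hf i).1] at key
    simpa [hunaryConj _ (hf _).1, (hf _).2] using key
  refine ⟨θ, hconj, fun n => fUniformContinuousOn_of_conj θ _ (hconj n), fun n => ?_⟩
  refine fUniformContinuousOn_of_conj θ.symm (fun x i => θ (x i)) fun k hk x => ?_
  have := hconj n _ (hξ'.1 n hk) fun i => θ (x i)
  rw [hr n k hk] at this
  simp [this]
end

section
/- Let F be a closed clone on a set A whose unary part F⁽¹⁾ is weakly directed, and let F' be a clone on a set B that is not closed. Then there is no surjective clone homomorphism ξ: F → F' whose restriction to the unary parts is induced by some bijection θ: A → B (i.e. with ξ(f) = θ∘f∘θ⁻¹ for all f ∈ F⁽¹⁾). -/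
open Set Function

universe u

/-- A weakly directed unary part reaches any finite tuple simultaneously from a single point. -/
theorem IsClone.exists_unary_preimage {A : Type*} [Nonempty A]
    {F : ∀ n : ℕ, Set ((Fin n → A) → A)} (hF : IsClone F)
    (hwd : ∀ a b : A, ∃ f ∈ F 1, ∃ g ∈ F 1, ∃ c : A,
      f (fun _ => c) = a ∧ g (fun _ => c) = b) (n : ℕ) (x : Fin n → A) :
    ∃ (c : A) (g : Fin n → ((Fin 1 → A) → A)),
      (∀ i, g i ∈ F 1) ∧ ∀ i, g i (fun _ => c) = x i := by
  induction n with
  | zero => exact ⟨Classical.arbitrary A, fun i => i.elim0, fun i => i.elim0, fun i => i.elim0⟩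
  | succ n ih =>
    obtain ⟨c, g, hg, hgc⟩ := ih (fun i => x i.succ)
    obtain ⟨h, hh, k, hk, d, hd, kd⟩ := hwd c (x 0)
    refine ⟨d, Fin.cons k (fun i y => g i (fun _ => h y)), fun i => ?_, fun i => ?_⟩
    · refine Fin.cases ?_ (fun j => ?_) i
      · simpa using hk
      · simpa using hF.2 1 1 (g j) (hg j) (fun _ => h) (fun _ => hh)
    · refine Fin.cases ?_ (fun j => ?_) i
      · simpa using kd
      · simp [hd, hgc]

/-- A clone homomorphism which is conjugation by `θ` on a weakly directed unary part is
conjugation by `θ` in every arity. -/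
theorem CloneHomOn.apply_eq_conj {A B : Type*}
    {F : ∀ n : ℕ, Set ((Fin n → A) → A)} {F' : ∀ n : ℕ, Set ((Fin n → B) → B)}
    (hF : IsClone F)
    (hwd : ∀ a b : A, ∃ f ∈ F 1, ∃ g ∈ F 1, ∃ c : A,
      f (fun _ => c) = a ∧ g (fun _ => c) = b)
    {ξ : ∀ n : ℕ, ((Fin n → A) → A) → ((Fin n → B) → B)} {θ : A ≃ B}
    (hξ : CloneHomOn F F' ξ)
    (hθ : ∀ f ∈ F 1, ∀ y : Fin 1 → B, ξ 1 f y = θ (f (fun i => θ.symm (y i))))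
    {n : ℕ} {f : (Fin n → A) → A} (hf : f ∈ F n) (x : Fin n → A) :
    ξ n f (fun i => θ (x i)) = θ (f x) := by
  have : Nonempty A := ⟨f x⟩
  obtain ⟨c, g, hg, hgc⟩ := hF.exists_unary_preimage hwd n x
  have h := congrFun (hξ.2.2 n 1 f hf g hg) (fun _ => θ c)
  rw [hθ _ (hF.2 n 1 f hf g hg)] at h
  simpa [hθ _ (hg _), hgc] using h.symm

/-- Conjugation by a bijection preserves closedness. -/
theorem fIsClosed.preimage_conj {A B : Type*} (θ : A ≃ B) {n : ℕ} {S : Set ((Fin n → A) → A)}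
    (hS : fIsClosed S) :
    fIsClosed {h : (Fin n → B) → B |
      (fun x : Fin n → A => θ.symm (h (fun i => θ (x i)))) ∈ S} := by
  let : UniformSpace A := ⊥
  let : UniformSpace B := ⊥
  have : DiscreteTopology B := ⟨rfl⟩
  have hc : Continuous (fun (h : (Fin n → B) → B) (x : Fin n → A) =>
      θ.symm (h (fun i => θ (x i)))) :=
    continuous_pi fun x => continuous_of_discreteTopology.comp (continuous_apply _)
  exact IsClosed.preimage hc hS

/-- There is no surjective clone homomorphism from a closed
clone with weakly directed unary part onto a non-closed clone whose unary
restriction is induced by conjugation with a bijection. -/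
theorem no_surjective_hom_onto_nonclosed_clone
    {A B : Type*} (F : ∀ n : ℕ, Set ((Fin n → A) → A)) (hF : IsClone F)
    (hFclosed : ∀ n, fIsClosed (F n))
    (hwd : ∀ a b : A, ∃ f ∈ F 1, ∃ g ∈ F 1, ∃ c : A,
      f (fun _ => c) = a ∧ g (fun _ => c) = b)
    (F' : ∀ n : ℕ, Set ((Fin n → B) → B)) (hF' : IsClone F')
    (hF'notclosed : ¬ ∀ n, fIsClosed (F' n)) :
    ¬ ∃ (ξ : ∀ n : ℕ, ((Fin n → A) → A) → ((Fin n → B) → B)) (θ : A ≃ B),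
        CloneHomOn F F' ξ ∧ (∀ n, Set.SurjOn (ξ n) (F n) (F' n)) ∧
        ∀ f ∈ F 1, ∀ y : Fin 1 → B, ξ 1 f y = θ (f (fun i => θ.symm (y i))) := by
  rintro ⟨ξ, θ, hξ, hsurj, hθ⟩
  refine hF'notclosed fun n => ?_
  convert (hFclosed n).preimage_conj θ using 1
  ext h
  constructor
  · intro hh
    obtain ⟨f, hf, rfl⟩ := hsurj n hh
    simpa [hξ.apply_eq_conj hF hwd hθ hf] using hf
  · intro hh
    have key : ξ n (fun x => θ.symm (h (fun i => θ (x i)))) = h := by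
      funext y
      simpa using hξ.apply_eq_conj hF hwd hθ hh (fun i => θ.symm (y i))
    exact key ▸ hξ.1 n hh
end

section
/- Let S be a set of functions A → A closed under composition (a transformation semigroup) on a non-empty set A, and suppose S is weakly directed. Then for every n ∈ ℕ and all a₁,…,aₙ ∈ A there exist f₁,…,fₙ ∈ S and a₀ ∈ A such that fᵢ(a₀) = aᵢ for all 1 ≤ i ≤ n. -/
/-- A weakly directed transformation semigroup on a
non-empty set can simultaneously reach any finite tuple of points from a
single point. -/
theorem weakly_directed_simultaneous
    {A : Type*} [Nonempty A] (S : Set (A → A))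
    (hcomp : ∀ f ∈ S, ∀ g ∈ S, f ∘ g ∈ S)
    (hwd : ∀ a b : A, ∃ f ∈ S, ∃ g ∈ S, ∃ c : A, f c = a ∧ g c = b) :
    ∀ (n : ℕ) (a : Fin n → A), ∃ (f : Fin n → (A → A)) (a₀ : A),
      (∀ i, f i ∈ S) ∧ ∀ i, f i a₀ = a i := by
  intro n
  induction n with
  | zero =>
    intro a
    exact ⟨Fin.elim0, Classical.arbitrary A, fun i => i.elim0, fun i => i.elim0⟩
  | succ n ih =>
    intro a
    obtain ⟨f, a₀, hf, hfa⟩ := ih (Fin.tail a)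
    obtain ⟨p, hp, q, hq, c, hpc, hqc⟩ := hwd (a 0) a₀
    refine ⟨Fin.cons p fun i => f i ∘ q, c, Fin.cases hp fun i => ?_, Fin.cases hpc fun i => ?_⟩
    · exact hcomp (f i) (hf i) q hq
    · simpa [hqc, Fin.tail] using hfa i
end

section
/- Let G be a group of permutations of a set A that has no algebraicity, meaning: for every finite subset B ⊆ A and every a ∈ A, if the orbit of a under the pointwise stabilizer G_(B) = {g ∈ G : g(b) = b for all b ∈ B} is finite, then a ∈ B. Then the centre of G is trivial: the only element of G commuting with every element of G is the identity permutation. -/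
/-- A permutation group without algebraicity (every point
with finite orbit under the pointwise stabilizer of a finite set `B` already
lies in `B`) has trivial centre. -/
theorem no_algebraicity_trivial_centre
    {A : Type*} (G : Subgroup (Equiv.Perm A))
    (hna : ∀ B : Set A, B.Finite → ∀ a : A,
      Set.Finite {x : A | ∃ g ∈ G, (∀ b ∈ B, g b = b) ∧ g a = x} → a ∈ B) :
    ∀ g ∈ G, (∀ h ∈ G, g * h = h * g) → g = 1 := by
  intro g _ hcomm
  ext a
  refine hna {a} (Set.finite_singleton a) (g a) ((Set.finite_singleton (g a)).subset ?_)
  rintro x ⟨h, hG, hfix, rfl⟩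
  have key : g (h a) = h (g a) := DFunLike.congr_fun (hcomm h hG) a
  rw [hfix a rfl] at key
  exact key.symm
end
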